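/- For every smooth matrix field S : ℝ³ → ℝ^{3×3} one has Rot((Rot(sym S))^⊤) = sym Rot((Rot S)^⊤), i.e. RotRot^⊤(sym S) = sym(RotRot^⊤ S). -/

import Mathlib

open Matrix

noncomputable section

/-- Points of `ℝ³`. -/
abbrev V3 := Fin 3 → ℝ
/-- Real `3×3` matrices. -/
abbrev M3 := Matrix (Fin 3) (Fin 3) ℝ

/-- Partial derivative `∂ᵢ f` of a scalar function on `ℝ³`. -/
def pd (i : Fin 3) (f : V3 → ℝ) (x : V3) : ℝ := fderiv ℝ f x (Pi.single i 1)

/-- Gradient of a scalar function. -/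
def grad (f : V3 → ℝ) (x : V3) : V3 := fun i => pd i f x

/-- Divergence of a vector field. -/
def vdiv (v : V3 → V3) (x : V3) : ℝ := ∑ i, pd i (fun y => v y i) x

/-- Curl (rotation) of a vector field. -/
def vrot (v : V3 → V3) (x : V3) : V3 :=
  ![pd 1 (fun y => v y 2) x - pd 2 (fun y => v y 1) x,
    pd 2 (fun y => v y 0) x - pd 0 (fun y => v y 2) x,
    pd 0 (fun y => v y 1) x - pd 1 (fun y => v y 0) x]

/-- Jacobian matrix `(Grad v)_{ij} = ∂_j v_i` of a vector field. -/
def vGrad (v : V3 → V3) (x : V3) : M3 := Matrix.of fun i j => pd j (fun y => v y i) x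

/-- Row-wise curl of a matrix field. -/
def mRot (S : V3 → M3) (x : V3) : M3 := Matrix.of fun i => vrot (fun y => S y i) x

/-- Row-wise divergence of a matrix field. -/
def mDiv (S : V3 → M3) (x : V3) : V3 := fun i => vdiv (fun y => S y i) x

/-- The second order operator `RotRot^⊤ S = Rot ((Rot S)ᵀ)`. -/
def rotRotT (S : V3 → M3) (x : V3) : M3 := mRot (fun y => (mRot S y)ᵀ) x

/-- Symmetric part of a matrix. -/
def msym (M : M3) : M3 := (2⁻¹ : ℝ) • (M + Mᵀ)

/-- Skew-symmetric part of a matrix. -/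
def mskw (M : M3) : M3 := (2⁻¹ : ℝ) • (M - Mᵀ)

/-- Deviatoric (trace-free) part of a matrix. -/
def mdev (M : M3) : M3 := M - (Matrix.trace M / 3) • (1 : M3)

/-- The skew-symmetric matrix `spn w` with `(spn w) x = w × x`. -/
def spn (w : V3) : M3 := !![0, -w 2, w 1; w 2, 0, -w 0; -w 1, w 0, 0]

/-- The axial vector of a (skew-symmetric) matrix; inverse of `spn`. -/
def spnInv (M : M3) : V3 := ![M 2 1, M 0 2, M 1 0]

end

lemma pd_add {f g : V3 → ℝ} (hf : Differentiable ℝ f) (hg : Differentiable ℝ g) (i : Fin 3) :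
    pd i (fun y => f y + g y) = fun y => pd i f y + pd i g y := by
  funext x
  simp [pd, fderiv_fun_add (hf x) (hg x)]

lemma pd_sub {f g : V3 → ℝ} (hf : Differentiable ℝ f) (hg : Differentiable ℝ g) (i : Fin 3) :
    pd i (fun y => f y - g y) = fun y => pd i f y - pd i g y := by
  funext x
  simp [pd, fderiv_fun_sub (hf x) (hg x)]

lemma pd_const_mul {f : V3 → ℝ} (hf : Differentiable ℝ f) (c : ℝ) (i : Fin 3) :
    pd i (fun y => c * f y) = fun y => c * pd i f y := by
  funext x
  simp [pd, fderiv_const_mul (hf x) c]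

lemma differentiable_pd {f : V3 → ℝ} (hf : ContDiff ℝ 2 f) (i : Fin 3) :
    Differentiable ℝ (pd i f) :=
  ((hf.fderiv_right (m := 1) (by norm_num)).clm_apply contDiff_const).differentiable (by norm_num)

/-- Partial derivatives of a `C²` function commute. -/
lemma pd_comm {f : V3 → ℝ} (hf : ContDiff ℝ 2 f) (i j : Fin 3) (x : V3) :
    pd i (pd j f) x = pd j (pd i f) x := by
  have hd : DifferentiableAt ℝ (fderiv ℝ f) x :=
    (hf.fderiv_right (m := 1) (by norm_num)).differentiable (by norm_num) x
  have hpd (k l : Fin 3) :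
      pd k (pd l f) x = fderiv ℝ (fderiv ℝ f) x (Pi.single k 1) (Pi.single l 1) := by
    change fderiv ℝ (fun y => fderiv ℝ f y (Pi.single l 1)) x (Pi.single k 1) = _
    simp [fderiv_clm_apply hd (differentiableAt_const _)]
  rw [hpd, hpd]
  exact (hf.contDiffAt.isSymmSndFDerivAt (by simp)).eq _ _

/-- Transposing a matrix field transposes `rotRotT` of it. -/
lemma rotRotT_transpose {S : V3 → M3} (hS : ∀ i j, ContDiff ℝ 2 fun y => S y i j) (x : V3) :
    rotRotT (fun y => (S y)ᵀ) x = (rotRotT S x)ᵀ := by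
  have hd (i j k : Fin 3) : Differentiable ℝ (pd k fun y => S y i j) := differentiable_pd (hS i j) k
  ext i j
  fin_cases i <;> fin_cases j <;>
    simp [rotRotT, mRot, vrot, pd_sub (hd _ _ _) (hd _ _ _), pd_comm (hS _ _) 1 0,
      pd_comm (hS _ _) 2 0, pd_comm (hS _ _) 2 1] <;>
    ring

/-- `rotRotT` is additive on `C²` matrix fields. -/
lemma rotRotT_add {S T : V3 → M3} (hS : ∀ i j, ContDiff ℝ 2 fun y => S y i j)
    (hT : ∀ i j, ContDiff ℝ 2 fun y => T y i j) (x : V3) :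
    rotRotT (fun y => S y + T y) x = rotRotT S x + rotRotT T x := by
  have hS₀ (i j : Fin 3) : Differentiable ℝ fun y => S y i j :=
    (hS i j).differentiable (by norm_num)
  have hT₀ (i j : Fin 3) : Differentiable ℝ fun y => T y i j :=
    (hT i j).differentiable (by norm_num)
  have hS₁ (i j k : Fin 3) : Differentiable ℝ (pd k fun y => S y i j) :=
    differentiable_pd (hS i j) k
  have hT₁ (i j k : Fin 3) : Differentiable ℝ (pd k fun y => T y i j) :=
    differentiable_pd (hT i j) k
  ext i j
  fin_cases j <;>
    simp [rotRotT, mRot, vrot] <;> fin_cases i <;>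
    simp [pd_add (hS₀ _ _) (hT₀ _ _), pd_sub (hS₁ _ _ _) (hS₁ _ _ _),
      pd_sub (hT₁ _ _ _) (hT₁ _ _ _), pd_add (hS₁ _ _ _) (hT₁ _ _ _),
      pd_sub ((hS₁ _ _ _).fun_add (hT₁ _ _ _)) ((hS₁ _ _ _).fun_add (hT₁ _ _ _))] <;>
    ring

/-- `rotRotT` is homogeneous on `C²` matrix fields. -/
lemma rotRotT_smul {S : V3 → M3} (hS : ∀ i j, ContDiff ℝ 2 fun y => S y i j) (c : ℝ) (x : V3) :
    rotRotT (fun y => c • S y) x = c • rotRotT S x := by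
  have hS₀ (i j : Fin 3) : Differentiable ℝ fun y => S y i j :=
    (hS i j).differentiable (by norm_num)
  have hS₁ (i j k : Fin 3) : Differentiable ℝ (pd k fun y => S y i j) :=
    differentiable_pd (hS i j) k
  ext i j
  fin_cases j <;>
    simp [rotRotT, mRot, vrot] <;> fin_cases i <;>
    simp [pd_const_mul (hS₀ _ _), pd_sub (hS₁ _ _ _) (hS₁ _ _ _), pd_const_mul (hS₁ _ _ _),
      pd_sub ((hS₁ _ _ _).const_mul c) ((hS₁ _ _ _).const_mul c)] <;>
    ring

/-- `RotRot^⊤ (sym S) = sym (RotRot^⊤ S)`. -/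
theorem rotRotT_msym (S : V3 → M3)
    (hS : ∀ i j, ContDiff ℝ (⊤ : ℕ∞) fun y => S y i j) :
    ∀ x, rotRotT (fun y => msym (S y)) x = msym (rotRotT S x) := by
  intro x
  have h (i j : Fin 3) : ContDiff ℝ 2 fun y => S y i j := contDiff_infty.mp (hS i j) 2
  have ht (i j : Fin 3) : ContDiff ℝ 2 fun y => (S y)ᵀ i j := h j i
  have hadd (i j : Fin 3) : ContDiff ℝ 2 fun y => (S y + (S y)ᵀ) i j := (h i j).add (ht i j)
  simp only [msym]
  rw [rotRotT_smul hadd, rotRotT_add h ht, rotRotT_transpose h]
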